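/- For every k ∈ ℕ, every L ≥ 1, and every φ ∈ D, the conjugated regularized interaction satisfies the norm bound ‖M^{−k} X_L M^k φ‖ ≤ (2^k + 1)(L+1)^{3/2} ‖φ‖, where X_L := a Q_L + a† Q_{L−1} and M := N + 1 (so M e_n = (n+1) e_n and M^{−k} e_n = (n+1)^{−k} e_n). -/

import Mathlib

open Filter Topology
open scoped ENNReal

noncomputable section

/-- The boson Hilbert space `H = ℓ²(ℕ, ℂ)`. -/
abbrev Hb : Type := lp (fun _ : ℕ => ℂ) 2

/-- The standard orthonormal basis vectors `e n` of `H`. -/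
def eb (n : ℕ) : Hb := lp.single 2 n (1 : ℂ)

/-- The dense subspace `D` of finitely supported linear combinations of the `e n`,
modelled as finitely supported sequences. -/
abbrev Db : Type := ℕ →₀ ℂ

/-- The inclusion `D → H`. -/
def incl : Db →ₗ[ℂ] Hb := Finsupp.linearCombination ℂ eb

/-- The annihilation operator `a : D → D`, `a e₀ = 0`, `a eₙ = √n e_{n-1}`. -/
def aOp : Db →ₗ[ℂ] Db :=
  Finsupp.lsum ℂ fun n => (Real.sqrt n : ℂ) • Finsupp.lsingle (n - 1)

/-- The creation operator `a† : D → D`, `a† eₙ = √(n+1) e_{n+1}`. -/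
def adOp : Db →ₗ[ℂ] Db :=
  Finsupp.lsum ℂ fun n => (Real.sqrt (n + 1) : ℂ) • Finsupp.lsingle (n + 1)

/-- The number operator `N = a† a` on `D`. -/
def ND : Db →ₗ[ℂ] Db := adOp ∘ₗ aOp

/-- The projection `Π_l` restricted to `D`. -/
def PiD (l : ℕ) : Db →ₗ[ℂ] Db :=
  Finsupp.lsum ℂ fun n => if n = l then Finsupp.lsingle n else 0

/-- `Q_L = Σ_{l=0}^L Π_l` on `D`. -/
def QD (L : ℕ) : Db →ₗ[ℂ] Db := ∑ l ∈ Finset.range (L + 1), PiD l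

/-- The orthogonal projection `Π_l` of `H` onto `ℂ e_l`. -/
def PiH (l : ℕ) : Hb →L[ℂ] Hb := (innerSL ℂ (eb l)).smulRight (eb l)

/-- `Q_L = Σ_{l=0}^L Π_l` on `H`. -/
def QH (L : ℕ) : Hb →L[ℂ] Hb := ∑ l ∈ Finset.range (L + 1), PiH l

/-- For a linear map `T : D → H`, the bounded operator `Π_l T Π_s` on `H`
(it is `x ↦ ⟪e_s, x⟫ • Π_l (T e_s)`, of rank at most one). -/
def sandwich (T : Db →ₗ[ℂ] Hb) (l s : ℕ) : Hb →L[ℂ] Hb :=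
  (innerSL ℂ (eb s)).smulRight (PiH l (T (Finsupp.single s 1)))

/-- Membership in the set `𝒞` of positive, bounded, continuous functions on `[0,∞)`
decreasing faster than any inverse power. -/
structure IsC (f : ℝ → ℝ) : Prop where
  cont : ContinuousOn f (Set.Ici (0 : ℝ))
  bdd : ∃ B : ℝ, ∀ x ∈ Set.Ici (0 : ℝ), f x ≤ B
  pos : ∀ x ∈ Set.Ici (0 : ℝ), 0 < f x
  decay : ∀ n : ℕ, Tendsto (fun x : ℝ => x ^ n * f x) atTop (nhds 0)

/-- The seminorm `p_{f,k}(T) = Σ_{l,s} f(l) s^k ‖Π_l T Π_s‖ ∈ [0,∞]`. -/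
def semin (f : ℝ → ℝ) (k : ℕ) (T : Db →ₗ[ℂ] Hb) : ℝ≥0∞ :=
  ∑' (l : ℕ) (s : ℕ), ENNReal.ofReal (f l * (s : ℝ) ^ k * ‖sandwich T l s‖)

end

noncomputable section

lemma incl_single (n : ℕ) (c : ℂ) : incl (Finsupp.single n c) = c • eb n := by
  simp [incl]

lemma norm_eb (n : ℕ) : ‖eb n‖ = 1 := by
  simp [eb, lp.norm_single]

lemma incl_apply (φ : Db) (n : ℕ) : incl φ n = φ n := by
  induction φ using Finsupp.induction_linear with
  | zero => simp
  | add f g hf hg => simp [hf, hg]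
  | single m c =>
    rw [incl_single]
    by_cases h : n = m
    · subst h; simp [eb]
    · simp [eb, h]

lemma norm_apply_le_norm_incl (φ : Db) (n : ℕ) : ‖φ n‖ ≤ ‖incl φ‖ := by
  rw [← incl_apply]
  exact lp.norm_apply_le_norm (by simp) (incl φ) n

lemma aOp_single (n : ℕ) (c : ℂ) :
    aOp (Finsupp.single n c) = (Real.sqrt n : ℂ) • Finsupp.single (n - 1) c := by
  simp [aOp]

lemma adOp_single (n : ℕ) (c : ℂ) :
    adOp (Finsupp.single n c) = (Real.sqrt (n + 1) : ℂ) • Finsupp.single (n + 1) c := by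
  simp [adOp]

lemma PiD_single (l n : ℕ) (c : ℂ) :
    PiD l (Finsupp.single n c) = if n = l then Finsupp.single n c else 0 := by
  by_cases h : n = l <;> simp [PiD, h]

lemma QD_single (L n : ℕ) (c : ℂ) :
    QD L (Finsupp.single n c) = if n ≤ L then Finsupp.single n c else 0 := by
  simp [QD, PiD_single, LinearMap.sum_apply]

lemma ND_single (n : ℕ) (c : ℂ) :
    ND (Finsupp.single n c) = (n : ℂ) • Finsupp.single n c := by
  rcases n with _ | n
  · simp [ND, aOp_single]
  · have h : (Real.sqrt ((n : ℝ) + 1) : ℂ) * Real.sqrt ((n : ℝ) + 1) = n + 1 := by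
      rw [← Complex.ofReal_mul, Real.mul_self_sqrt (by positivity)]
      push_cast; rfl
    rw [ND, LinearMap.comp_apply, aOp_single, map_smul, Nat.add_sub_cancel, adOp_single, smul_smul]
    push_cast
    rw [h]

lemma ND_add_one_pow_single (k n : ℕ) (c : ℂ) :
    ((ND + 1) ^ k) (Finsupp.single n c) = ((n : ℂ) + 1) ^ k • Finsupp.single n c := by
  induction k with
  | zero => simp
  | succ k ih =>
    rw [pow_succ', Module.End.mul_apply, ih, map_smul, LinearMap.add_apply, ND_single,
      Module.End.one_apply, pow_succ, mul_smul, add_smul, one_smul]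

/-- The conjugate of a weighted shift `e n ↦ r e m` by powers of `N + 1`, applied to `e n`. -/
lemma norm_conj_shift (k n m : ℕ) (r : ℝ) (hr : 0 ≤ r)
    (Minv : Hb →L[ℂ] Hb)
    (hMinv : ∀ n : ℕ, Minv (eb n) = (((n : ℂ) + 1) ^ k)⁻¹ • eb n) :
    ‖Minv (incl (((n : ℂ) + 1) ^ k • (r : ℂ) • Finsupp.single m 1))‖
      = (((n : ℝ) + 1) / (m + 1)) ^ k * r := by
  have h (j : ℕ) : ‖(j : ℂ) + 1‖ = (j : ℝ) + 1 := by
    exact_mod_cast Complex.norm_natCast (j + 1)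
  rw [map_smul, map_smul, map_smul, incl_single, one_smul, map_smul, hMinv]
  simp only [norm_smul, norm_pow, norm_inv, h, norm_eb, Complex.norm_real, Real.norm_eq_abs,
    abs_of_nonneg hr, div_pow]
  ring

lemma norm_conj_aOp_single_le (k L n : ℕ) (hn : n ≤ L)
    (Minv : Hb →L[ℂ] Hb)
    (hMinv : ∀ n : ℕ, Minv (eb n) = (((n : ℂ) + 1) ^ k)⁻¹ • eb n) :
    ‖Minv (incl (((n : ℂ) + 1) ^ k • aOp (Finsupp.single n 1)))‖
      ≤ 2 ^ k * Real.sqrt (L + 1) := by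
  rw [aOp_single, norm_conj_shift k n (n - 1) _ (Real.sqrt_nonneg _) Minv hMinv]
  have hnL : (n : ℝ) ≤ L + 1 := by exact_mod_cast hn.trans L.le_succ
  gcongr
  rw [div_le_iff₀ (by positivity)]
  exact_mod_cast (by omega : n + 1 ≤ 2 * (n - 1 + 1))

lemma norm_conj_adOp_single_le (k L n : ℕ) (hn : n ≤ L)
    (Minv : Hb →L[ℂ] Hb)
    (hMinv : ∀ n : ℕ, Minv (eb n) = (((n : ℂ) + 1) ^ k)⁻¹ • eb n) :
    ‖Minv (incl (((n : ℂ) + 1) ^ k • adOp (Finsupp.single n 1)))‖ ≤ Real.sqrt (L + 1) := by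
  rw [adOp_single, norm_conj_shift k n (n + 1) _ (Real.sqrt_nonneg _) Minv hMinv]
  have hnL : (n : ℝ) ≤ L := by exact_mod_cast hn
  refine (mul_le_of_le_one_left (Real.sqrt_nonneg _) (pow_le_one₀ (by positivity) ?_)).trans
    (by gcongr)
  rw [div_le_one (by positivity)]
  push_cast
  linarith

/-- The interaction annihilates `e n` for `n > L`, and its conjugate by `(N + 1) ^ k` has norm at
most `(2 ^ k + 1) √(L + 1)` on the remaining basis vectors. -/
lemma norm_conj_interaction_single_le (k L n : ℕ)
    (Minv : Hb →L[ℂ] Hb)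
    (hMinv : ∀ n : ℕ, Minv (eb n) = (((n : ℂ) + 1) ^ k)⁻¹ • eb n) :
    ‖Minv (incl ((aOp * QD L + adOp * QD (L - 1)) (((ND + 1) ^ k) (Finsupp.single n 1))))‖
      ≤ if n ≤ L then (2 ^ k + 1) * Real.sqrt (L + 1) else 0 := by
  rw [ND_add_one_pow_single, map_smul, LinearMap.add_apply, Module.End.mul_apply,
    Module.End.mul_apply, QD_single, QD_single]
  split_ifs with h1 h2 h2
  · rw [smul_add, map_add, map_add, add_mul, one_mul]
    exact norm_add_le_of_le (norm_conj_aOp_single_le k L n h1 Minv hMinv)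
      (norm_conj_adOp_single_le k L n h1 Minv hMinv)
  · rw [map_zero, add_zero]
    refine (norm_conj_aOp_single_le k L n h1 Minv hMinv).trans ?_
    gcongr
    simp
  · omega
  · simp

/-- for every `k ∈ ℕ`, `L ≥ 1` and `φ ∈ D`,
`‖M⁻ᵏ X_L Mᵏ φ‖ ≤ (2ᵏ + 1)(L+1)^{3/2} ‖φ‖`, where `X_L = a Q_L + a† Q_{L-1}`,
`M = N + 1` (so `M eₙ = (n+1) eₙ`) and `M⁻ᵏ` is the bounded operator with
`M⁻ᵏ eₙ = (n+1)⁻ᵏ eₙ`. -/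
theorem stmt16 (k L : ℕ) (hL : 1 ≤ L)
    (Minv : Hb →L[ℂ] Hb)
    (hMinv : ∀ n : ℕ, Minv (eb n) = (((n : ℂ) + 1) ^ k)⁻¹ • eb n)
    (φ : Db) :
    ‖Minv (incl ((aOp * QD L + adOp * QD (L - 1)) (((ND + 1) ^ k) φ)))‖
      ≤ (2 ^ k + 1) * ((L : ℝ) + 1) ^ ((3 : ℝ) / 2) * ‖incl φ‖ := by
  set T : Db →ₗ[ℂ] Hb :=
    (Minv : Hb →ₗ[ℂ] Hb) ∘ₗ incl ∘ₗ (aOp * QD L + adOp * QD (L - 1)) ∘ₗ ((ND + 1) ^ k)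
  have hT1 (n : ℕ) : ‖T (Finsupp.single n 1)‖
      ≤ if n ≤ L then (2 ^ k + 1) * Real.sqrt (L + 1) else 0 :=
    norm_conj_interaction_single_le k L n Minv hMinv
  have hsum : T φ = ∑ n ∈ φ.support, φ n • T (Finsupp.single n 1) := by
    conv_lhs => rw [← Finsupp.sum_single φ]
    rw [Finsupp.sum, map_sum]
    refine Finset.sum_congr rfl fun n _ => ?_
    rw [← map_smul, Finsupp.smul_single_one]
  have hpow : ((L : ℝ) + 1) ^ ((3 : ℝ) / 2) = (L + 1) * Real.sqrt (L + 1) := by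
    rw [Real.sqrt_eq_rpow, ← Real.rpow_one_add' (by positivity) (by norm_num)]
    norm_num
  have hcard : ((φ.support.filter (· ≤ L)).card : ℝ) ≤ L + 1 := by
    have : φ.support.filter (· ≤ L) ⊆ Finset.range (L + 1) := fun n hn => by
      simp only [Finset.mem_filter] at hn
      exact Finset.mem_range_succ_iff.2 hn.2
    exact_mod_cast (Finset.card_le_card this).trans (Finset.card_range _).le
  calc ‖T φ‖ ≤ ∑ n ∈ φ.support, ‖φ n • T (Finsupp.single n 1)‖ := by
        rw [hsum]; exact norm_sum_le _ _
    _ ≤ ∑ n ∈ φ.support,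
          if n ≤ L then ‖incl φ‖ * ((2 ^ k + 1) * Real.sqrt (L + 1)) else 0 := by
        refine Finset.sum_le_sum fun n _ => ?_
        rw [norm_smul, ← mul_ite_zero]
        exact mul_le_mul (norm_apply_le_norm_incl φ n) (hT1 n) (norm_nonneg _) (norm_nonneg _)
    _ = (φ.support.filter (· ≤ L)).card * (‖incl φ‖ * ((2 ^ k + 1) * Real.sqrt (L + 1))) := by
        rw [← Finset.sum_filter, Finset.sum_const, nsmul_eq_mul]
    _ ≤ (L + 1) * (‖incl φ‖ * ((2 ^ k + 1) * Real.sqrt (L + 1))) := by gcongr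
    _ = (2 ^ k + 1) * ((L : ℝ) + 1) ^ ((3 : ℝ) / 2) * ‖incl φ‖ := by rw [hpow]; ring

end
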